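/- Let ℓ ≥ 1 and m ≥ 1 be integers and let y ∈ S_{ℓ·2^m} be a product of ℓ disjoint cycles of length 2^m. Then: (i) if ℓ = 1, then Sub_{S_{2^m}}(y) = P, where P is the unique Sylow 2-subgroup of S_{2^m} containing y; (ii) if ℓ > 1, then Sub_{S_{ℓ·2^m}}(y) = S_{ℓ·2^m}. -/

import Mathlib

open CategoryTheory

noncomputable section

/-- The set of irreducible complex characters of a group `G`. -/
def Irr (G : Type) [Group G] : Set (G → ℂ) :=
  {χ | ∃ V : FDRep ℂ G, Simple V ∧ V.character = χ}

/-- The irreducible characters of `G` that do not vanish at `g`. -/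
def IrrX (G : Type) [Group G] (g : G) : Set (G → ℂ) :=
  {χ | χ ∈ Irr G ∧ χ g ≠ 0}

/-- The irreducible characters of `G` of degree not divisible by `p`. -/
def IrrP' (p : ℕ) (G : Type) [Group G] : Set (G → ℂ) :=
  {χ | ∃ V : FDRep ℂ G, Simple V ∧ V.character = χ ∧ ¬ (p ∣ Module.finrank ℂ V)}

/-- The degree of a character, recovered from its value at `1`. -/
def charDeg {G : Type} [Group G] (χ : G → ℂ) : ℕ := ⌊(χ 1).re⌋₊

/-- The `p`-part of a natural number. -/
def pPart (p m : ℕ) : ℕ := p ^ (m.factorization p)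

/-- `x` is a picky `p`-element: a `p`-element lying in a unique Sylow `p`-subgroup. -/
def IsPicky (p : ℕ) {G : Type*} [Group G] (x : G) : Prop :=
  (∃ k, orderOf x = p ^ k) ∧ ∃! Q : Sylow p G, x ∈ Q

/-- `H` is a normal subgroup of `K` (both subgroups of an ambient group `G`). -/
def NormalIn {G : Type*} [Group G] (H K : Subgroup G) : Prop :=
  H ≤ K ∧ ∀ k ∈ K, ∀ h ∈ H, k * h * k⁻¹ ∈ H

/-- `H` is subnormal in `K`: there is a finite chain of subgroups from `H` to `K`,
each normal in the next. -/
def IsSubnormalIn {G : Type*} [Group G] (H K : Subgroup G) : Prop :=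
  Relation.ReflTransGen NormalIn H K

/-- The subnormalizer of `x` in `G`: the subgroup generated by all `g` such that
`⟨x⟩` is subnormal in `⟨x, g⟩`. -/
def subnormalizer {G : Type*} [Group G] (x : G) : Subgroup G :=
  Subgroup.closure {g | IsSubnormalIn (Subgroup.zpowers x) (Subgroup.closure {x, g})}

lemma mem_subnormalizer_self {G : Type*} [Group G] (x : G) : x ∈ subnormalizer x :=
  Subgroup.subset_closure (by
    show IsSubnormalIn (Subgroup.zpowers x) (Subgroup.closure {x, x})
    rw [Set.pair_eq_singleton, ← Subgroup.zpowers_eq_closure]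
    exact Relation.ReflTransGen.refl)

/-- The full cycle type of a permutation of `Fin n`: the multiset of the lengths of
all its cycles, with fixed points counted as cycles of length `1`. -/
def fullCycleType {n : ℕ} (x : Equiv.Perm (Fin n)) : Multiset ℕ :=
  x.cycleType + Multiset.replicate (n - x.support.card) 1

/-- The multiset of cycle lengths of a `p`-adic element of `S_n`: `a_i` cycles of
length `p ^ i`, where `n = Σ a_i p ^ i` is the `p`-adic expansion of `n`. -/
def padicCycleMultiset (p n : ℕ) : Multiset ℕ :=
  ∑ i ∈ Finset.range (Nat.digits p n).length,
    Multiset.replicate ((Nat.digits p n).getD i 0) (p ^ i)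

/-- A `p`-adic element of `S_n`. -/
def IsPAdic (p : ℕ) {n : ℕ} (x : Equiv.Perm (Fin n)) : Prop :=
  fullCycleType x = padicCycleMultiset p n

/-- A picky element of Type II: a `2`-adic element on `n - 2` points together with
two fixed points. -/
def IsTypeII {n : ℕ} (x : Equiv.Perm (Fin n)) : Prop :=
  fullCycleType x = padicCycleMultiset 2 (n - 2) + Multiset.replicate 2 1

/-- A picky element of Type III: a `3`-adic element on `n - 3` points together with
three fixed points. -/
def IsTypeIII {n : ℕ} (x : Equiv.Perm (Fin n)) : Prop :=
  fullCycleType x = padicCycleMultiset 3 (n - 3) + Multiset.replicate 3 1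


section Subnormality

variable {G : Type*} [Group G]

lemma isSubnormalIn_top [Finite G] [Group.IsNilpotent G] (H : Subgroup G) :
    IsSubnormalIn H ⊤ := by
  induction H using WellFoundedGT.induction with
  | ind H ih =>
    rcases eq_or_ne H ⊤ with rfl | hne
    · exact Relation.ReflTransGen.refl
    · have hlt := Group.normalizerCondition_of_isNilpotent (G := G) H hne.lt_top
      refine Relation.ReflTransGen.head ⟨hlt.le, fun k hk h hh => ?_⟩ (ih _ hlt)
      exact (Subgroup.mem_normalizer_iff.1 hk h).1 hh

lemma IsPGroup.isSubnormalIn [Finite G] {p : ℕ} [Fact p.Prime] {H K : Subgroup G}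
    (hK : IsPGroup p K) (hHK : H ≤ K) : IsSubnormalIn H K := by
  have := hK.isNilpotent
  have hmap (A B : Subgroup K) (hAB : NormalIn A B) :
      NormalIn (A.map K.subtype) (B.map K.subtype) := by
    refine ⟨Subgroup.map_mono hAB.1, ?_⟩
    rintro _ ⟨k, hk, rfl⟩ _ ⟨h, hh, rfl⟩
    exact ⟨_, hAB.2 k hk h hh, by simp⟩
  have h : IsSubnormalIn ((H.subgroupOf K).map K.subtype) ((⊤ : Subgroup K).map K.subtype) :=
    Relation.ReflTransGen.lift _ hmap _ _ (isSubnormalIn_top (H.subgroupOf K))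
  rwa [Subgroup.map_subgroupOf_eq_of_le hHK, ← MonoidHom.range_eq_map,
    Subgroup.range_subtype] at h

lemma IsPGroup.le_subnormalizer [Finite G] {p : ℕ} [Fact p.Prime] {K : Subgroup G}
    (hK : IsPGroup p K) {x : G} (hx : x ∈ K) : K ≤ subnormalizer x := fun g hg => by
  have hle : Subgroup.closure {x, g} ≤ K := by
    rw [Subgroup.closure_le]; rintro a (rfl | rfl) <;> assumption
  refine Subgroup.subset_closure (IsPGroup.isSubnormalIn (hK.to_le hle) ?_)
  rw [Subgroup.zpowers_le]
  exact Subgroup.subset_closure (Set.mem_insert _ _)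

/-- If the conjugates of an involution `t` under `⟨x⟩` commute with `t`, where `x` is a
`2`-element, then `⟨x, t⟩` is a `2`-group. -/
lemma isPGroup_two_closure_pair {x t : G} {m : ℕ} (hx : x ^ 2 ^ m = 1) (ht : t * t = 1)
    (hc : ∀ i : ℤ, Commute (x ^ i * t * (x ^ i)⁻¹) t) :
    IsPGroup 2 (Subgroup.closure {x, t}) := by
  set S : Set G := Set.range fun i : ℤ => x ^ i * t * (x ^ i)⁻¹
  have hcomm : ∀ a ∈ S, ∀ b ∈ S, a * b = b * a := by
    rintro _ ⟨i, rfl⟩ _ ⟨j, rfl⟩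
    have h := (Commute.conj_iff (x ^ j)).2 (hc (i - j))
    have e : x ^ j * (x ^ (i - j) * t * (x ^ (i - j))⁻¹) * (x ^ j)⁻¹ =
        x ^ i * t * (x ^ i)⁻¹ := by group
    rw [e] at h
    exact h
  have := Subgroup.isMulCommutative_closure hcomm
  have hN : IsPGroup 2 (Subgroup.closure S) := by
    rintro ⟨g, hg⟩
    refine ⟨1, Subtype.ext ?_⟩
    suffices g * g = 1 by simpa [pow_two] using this
    induction hg using Subgroup.closure_induction with
    | mem a ha =>
      obtain ⟨i, rfl⟩ := ha
      calc _ = x ^ i * (t * t) * (x ^ i)⁻¹ := by group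
        _ = 1 := by rw [ht]; group
    | one => simp
    | mul a b ha hb iha ihb =>
      have hab : a * b = b * a := setLike_mul_comm ha hb
      calc a * b * (a * b) = a * (b * a) * b := by group
        _ = (a * a) * (b * b) := by rw [← hab]; group
        _ = 1 := by rw [iha, ihb, one_mul]
    | inv a ha iha => rw [← mul_inv_rev, iha, inv_one]
  have hX : IsPGroup 2 (Subgroup.zpowers x) := by
    rintro ⟨_, i, rfl⟩
    refine ⟨m, Subtype.ext ?_⟩
    simp only [Subgroup.coe_pow, Subgroup.coe_one]
    rw [← zpow_natCast, ← zpow_mul, mul_comm, zpow_mul, zpow_natCast, hx, one_zpow]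
  have hnorm : Subgroup.zpowers x ≤ Subgroup.normalizer (Subgroup.closure S : Set G) := by
    rw [Subgroup.le_normalizer_closure_iff]
    rintro _ ⟨i, rfl⟩ _ ⟨j, rfl⟩
    refine Subgroup.subset_closure ⟨i + j, ?_⟩
    simp only
    group
  refine (hN.to_sup_of_normal_left' hX hnorm).to_le ?_
  rw [Subgroup.closure_le]
  rintro a (rfl | rfl)
  · exact Subgroup.mem_sup_right (Subgroup.mem_zpowers _)
  · exact Subgroup.mem_sup_left (Subgroup.subset_closure ⟨0, by simp⟩)

end Subnormality

namespace Equiv.Perm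

variable {α : Type*}

lemma SameCycle.sq_or {f : Perm α} {u v : α} (h : SameCycle f u v) :
    SameCycle (f ^ 2) u v ∨ SameCycle (f ^ 2) (f u) v := by
  obtain ⟨i, rfl⟩ := h
  obtain ⟨j, rfl | rfl⟩ := Int.even_or_odd' i
  · exact Or.inl ⟨j, by rw [zpow_mul]; rfl⟩
  · exact Or.inr ⟨j, by rw [zpow_add, zpow_mul, zpow_one]; rfl⟩

lemma SameCycle.sq_pigeonhole {f : Perm α} {u v w : α} (huv : SameCycle f u v)
    (hvw : SameCycle f v w) :
    SameCycle (f ^ 2) u v ∨ SameCycle (f ^ 2) v w ∨ SameCycle (f ^ 2) u w := by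
  rcases huv.symm.sq_or with h | h
  · exact Or.inl h.symm
  · rcases hvw.sq_or with h' | h'
    · exact Or.inr (Or.inl h')
    · exact Or.inr (Or.inr (h.symm.trans h'))

lemma SameCycle.of_forall_apply {f g : Perm α} (h : ∀ x, SameCycle f (g x) x) {u v : α}
    (huv : SameCycle g u v) : SameCycle f u v := by
  obtain ⟨i, rfl⟩ := huv
  induction i using Int.induction_on with
  | zero => exact SameCycle.refl _ _
  | succ i ih =>
    rw [add_comm, zpow_add, zpow_one, mul_apply]
    exact ih.trans (h _).symm
  | pred i ih =>
    refine ih.trans ?_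
    have := h ((g ^ (-(i : ℤ) - 1)) u)
    rwa [← mul_apply, ← zpow_one_add, add_sub_cancel] at this

lemma apply_eq_self_of_sameCycle_sq {f : Perm α} {m : ℕ} (hf : f ^ 2 ^ m = 1) {u : α}
    (h : SameCycle (f ^ 2) u (f u)) : f u = u := by
  obtain ⟨t, ht⟩ := h
  have h1 : (f ^ (2 * t - 1)) u = u := by
    rw [sub_eq_neg_add, zpow_add, mul_apply, zpow_mul, zpow_neg, zpow_one, inv_eq_iff_eq]
    exact ht
  have hco : IsCoprime (2 * t - 1) ((2 : ℤ) ^ m) :=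
    IsCoprime.pow_right ⟨-1, t, by ring⟩
  obtain ⟨a, b, hab⟩ := hco
  have h2 : f ^ ((2 : ℤ) ^ m) = 1 := by exact_mod_cast hf
  calc f u = (f ^ (a * (2 * t - 1) + b * 2 ^ m)) u := by rw [hab, zpow_one]
    _ = (f ^ (a * (2 * t - 1))) u := by
      rw [zpow_add, mul_comm b, zpow_mul f (2 ^ m), h2, one_zpow, mul_one]
    _ = u := by
      rw [mul_comm, zpow_mul]
      exact zpow_apply_eq_self_of_apply_eq_self h1 a

/-- The permutations preserving, for every `k`, the partition into cycles of `y ^ 2 ^ k`. -/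
def cycleTreeStabilizer (y : Perm α) : Subgroup (Perm α) where
  carrier := {g | ∀ k u v, SameCycle (y ^ 2 ^ k) (g u) (g v) ↔ SameCycle (y ^ 2 ^ k) u v}
  one_mem' _ _ _ := Iff.rfl
  mul_mem' ha hb k u v := (ha k _ _).trans (hb k u v)
  inv_mem' {a} ha k u v := by
    rw [← ha k]
    simp

section CycleTree

variable {y : Perm α} (hy : ∀ u v, SameCycle y u v)

lemma self_mem_cycleTreeStabilizer (y : Perm α) : y ∈ cycleTreeStabilizer y := fun k u v => by
  have h := sameCycle_conj (f := y ^ 2 ^ k) (g := y) (x := y u) (y := y v)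
  have e : y * y ^ 2 ^ k * y⁻¹ = y ^ 2 ^ k := by group
  simpa [e] using h

include hy

lemma sameCycle_pow_two_pow_apply {g : Perm α} (hg : g ∈ cycleTreeStabilizer y) (k : ℕ) (x : α) :
    SameCycle (y ^ 2 ^ k) ((g ^ 2 ^ k) x) x := by
  induction k generalizing x with
  | zero => simpa using hy _ _
  | succ k ih =>
    rw [pow_succ 2 k, pow_mul, pow_mul, pow_two (g ^ 2 ^ k), mul_apply]
    have hW (u v) : SameCycle ((y ^ 2 ^ k) ^ 2) ((g ^ 2 ^ k) u) ((g ^ 2 ^ k) v) ↔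
        SameCycle ((y ^ 2 ^ k) ^ 2) u v := by
      have := pow_mem hg (2 ^ k) (k + 1) u v
      rwa [pow_succ 2 k, pow_mul] at this
    rcases (ih ((g ^ 2 ^ k) x)).sq_pigeonhole (ih x) with h | h | h
    · exact h.trans ((hW _ _).1 h)
    · exact ((hW _ _).2 h).trans h
    · exact h

lemma sameCycle_pow_two_pow_iff {m : ℕ} (hm : y ^ 2 ^ m = 1) {z : Perm α}
    (hz : z ∈ cycleTreeStabilizer y) (hz' : ∀ u v, SameCycle z u v) (k : ℕ) (u v : α) :
    SameCycle (z ^ 2 ^ k) u v ↔ SameCycle (y ^ 2 ^ k) u v := by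
  have hforward (k u v) : SameCycle (z ^ 2 ^ k) u v → SameCycle (y ^ 2 ^ k) u v :=
    SameCycle.of_forall_apply (sameCycle_pow_two_pow_apply hy hz k)
  refine ⟨hforward k u v, ?_⟩
  induction k generalizing u v with
  | zero => exact fun _ => by simpa using hz' u v
  | succ k ih =>
    intro huv
    have hstep := hforward (k + 1)
    rw [pow_succ 2 k, pow_mul] at huv ⊢
    simp only [pow_succ 2 k, pow_mul] at hstep
    rcases (ih u v huv.of_pow).sq_or with h | h
    · exact h
    · have hzu := (hstep _ _ h).trans huv.symm
      have hw : SameCycle ((y ^ 2 ^ k) ^ 2) u ((y ^ 2 ^ k) u) := by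
        rcases (ih u ((y ^ 2 ^ k) u) ⟨1, by simp⟩).sq_or with h' | h'
        · exact hstep _ _ h'
        · exact hzu.symm.trans (hstep _ _ h')
      have hfix : (y ^ 2 ^ k) u = u :=
        apply_eq_self_of_sameCycle_sq (m := m) (by rw [pow_right_comm, hm, one_pow]) hw
      obtain ⟨i, rfl⟩ := huv.of_pow
      rw [zpow_apply_eq_self_of_apply_eq_self hfix]

lemma isPGroup_cycleTreeStabilizer {m : ℕ} (hm : y ^ 2 ^ m = 1) :
    IsPGroup 2 (cycleTreeStabilizer y) := by
  rintro ⟨g, hg⟩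
  refine ⟨m, Subtype.ext (Equiv.ext fun x => ?_)⟩
  have h := sameCycle_pow_two_pow_apply hy hg m x
  rw [hm] at h
  simpa using h

lemma mem_cycleTreeStabilizer_of_conj_mem {m : ℕ} (hm : y ^ 2 ^ m = 1) {g : Perm α}
    (hg : g * y * g⁻¹ ∈ cycleTreeStabilizer y) : g ∈ cycleTreeStabilizer y := fun k u v => by
  rw [← sameCycle_pow_two_pow_iff hy hm hg (fun _ _ => sameCycle_conj.2 (hy _ _)), conj_pow,
    sameCycle_conj]
  simp

lemma subnormalizer_le_cycleTreeStabilizer {m : ℕ} (hm : y ^ 2 ^ m = 1) :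
    subnormalizer y ≤ cycleTreeStabilizer y := by
  refine (Subgroup.closure_le _).2 fun g hg => ?_
  have key (K : Subgroup (Perm α)) (hK : IsSubnormalIn (Subgroup.zpowers y) K) :
      y ∈ K ∧ K ≤ cycleTreeStabilizer y := by
    induction hK with
    | refl =>
      exact ⟨Subgroup.mem_zpowers y, Subgroup.zpowers_le.2 (self_mem_cycleTreeStabilizer y)⟩
    | tail _ hAB ih =>
      exact ⟨hAB.1 ih.1, fun k hk =>
        mem_cycleTreeStabilizer_of_conj_mem hy hm (ih.2 (hAB.2 k hk y ih.1))⟩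
  exact (key _ hg).2 (Subgroup.subset_closure (by simp))

theorem subnormalizer_eq_sylow [Finite α] {m : ℕ} (hm : y ^ 2 ^ m = 1)
    (P : Sylow 2 (Perm α)) (hP : y ∈ P) : subnormalizer y = P := by
  have hle : (P : Subgroup (Perm α)) ≤ subnormalizer y := P.isPGroup'.le_subnormalizer hP
  have hsub := subnormalizer_le_cycleTreeStabilizer hy hm
  exact P.is_maximal' ((isPGroup_cycleTreeStabilizer hy hm).to_le hsub) hle

end CycleTree

section Swap

variable [DecidableEq α] {y : Perm α} {m : ℕ} (hm : y ^ 2 ^ m = 1)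
  (hfree : ∀ (i : ℤ) (x : α), (y ^ i) x = x → y ^ i = 1)

include hm hfree

lemma swap_mem_subnormalizer [Finite α] {a b : α} (hab : ¬ SameCycle y a b) :
    swap a b ∈ subnormalizer y := by
  have hne (i : ℤ) : (y ^ i) a ≠ b := fun h => hab ⟨i, h⟩
  have hne' (i : ℤ) : (y ^ i) b ≠ a := fun h => hab (SameCycle.symm ⟨i, h⟩)
  refine (isPGroup_two_closure_pair hm (swap_mul_self a b) fun i => ?_).le_subnormalizer
    (Subgroup.subset_closure (by simp)) (Subgroup.subset_closure (by simp))
  by_cases hi : y ^ i = 1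
  · simp [hi]
  · have ha : (y ^ i) a ≠ a := fun h => hi (hfree i a h)
    have hb : (y ^ i) b ≠ b := fun h => hi (hfree i b h)
    rw [← swap_apply_apply]
    have hab' : a ≠ b := fun h => hab (h ▸ SameCycle.refl y a)
    exact (disjoint_swap_swap (by simp [ha, hb, hne i, hne' i, hab'])).commute

theorem subnormalizer_eq_top [Finite α] (hcycles : ∀ a, ∃ c, ¬ SameCycle y a c) :
    subnormalizer y = ⊤ := by
  rw [eq_top_iff, ← closure_isSwap, Subgroup.closure_le]
  rintro _ ⟨a, b, hne, rfl⟩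
  by_cases hab : SameCycle y a b
  · obtain ⟨c, hc⟩ := hcycles a
    have hac := swap_mem_subnormalizer hm hfree hc
    have hbc := swap_mem_subnormalizer hm hfree fun h => hc (hab.trans h)
    have hca : c ≠ a := fun h => hc (h ▸ SameCycle.refl y a)
    have e : swap a c * swap b c * (swap a c)⁻¹ = swap a b := by
      rw [← swap_apply_apply, swap_apply_of_ne_of_ne hne.symm, swap_apply_right, swap_comm]
      rintro rfl
      exact hc hab
    rw [← e]
    exact mul_mem (mul_mem hac hbc) (inv_mem hac)
  · exact swap_mem_subnormalizer hm hfree hab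

end Swap

section CycleType

variable [Fintype α] [DecidableEq α] {y : Perm α} {ℓ d : ℕ}
  (hy : y.cycleType = Multiset.replicate ℓ d)

include hy

lemma pow_eq_one_of_cycleType_eq_replicate : y ^ d = 1 := by
  rw [← orderOf_dvd_iff_pow_eq_one, ← lcm_cycleType, Multiset.lcm_dvd, hy]
  intro b hb
  rw [Multiset.eq_of_mem_replicate hb]

lemma apply_ne_self_of_cycleType_eq_replicate (hα : Fintype.card α = ℓ * d) (x : α) :
    y x ≠ x := by
  have h : y.support = Finset.univ := by
    rw [← Finset.card_eq_iff_eq_univ, ← sum_cycleType, hy, hα]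
    simp
  rw [← mem_support, h]
  exact Finset.mem_univ x

lemma card_support_cycleOf_of_cycleType_eq_replicate {x : α} (hx : y x ≠ x) :
    (y.cycleOf x).support.card = d := by
  have : (y.cycleOf x).support.card ∈ y.cycleType := by
    rw [cycleType_def]
    exact Multiset.mem_map.2
      ⟨_, cycleOf_mem_cycleFactorsFinset_iff.2 (mem_support.2 hx), rfl⟩
  rw [hy] at this
  exact Multiset.eq_of_mem_replicate this

lemma zpow_eq_one_of_cycleType_eq_replicate {i : ℤ} {x : α} (hx : y x ≠ x)
    (hi : (y ^ i) x = x) : y ^ i = 1 := by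
  have hc := isCycle_cycleOf y hx
  have ho := hc.orderOf
  rw [card_support_cycleOf_of_cycleType_eq_replicate hy hx] at ho
  have hmem : y ^ i ∈ Submonoid.powers y :=
    mem_powers_iff_mem_zpowers.2 ⟨i, rfl⟩
  obtain ⟨n, hn⟩ := hmem
  simp only at hn
  rw [← hn] at hi ⊢
  rw [← cycleOf_pow_apply_self] at hi
  have h1 := (hc.pow_eq_one_iff' (by rwa [cycleOf_apply_self])).2 hi
  obtain ⟨t, rfl⟩ := ho ▸ orderOf_dvd_of_pow_eq_one h1
  rw [pow_mul, pow_eq_one_of_cycleType_eq_replicate hy, one_pow]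

lemma exists_not_sameCycle_of_cycleType_eq_replicate (hℓ : ℓ ≠ 1) {x : α} (hx : y x ≠ x) :
    ∃ c, ¬ SameCycle y x c := by
  by_contra! h
  refine hℓ ?_
  have hc : y.IsCycle := ⟨x, hx, fun c _ => h c⟩
  simpa [hy] using card_cycleType_eq_one.2 hc

end CycleType

end Equiv.Perm

/-- For `y ∈ S_{ℓ·2^m}` a product of `ℓ` disjoint cycles of length `2^m`: if `ℓ = 1`
then `Sub(y)` is the unique Sylow `2`-subgroup containing `y`, and if `ℓ > 1` then
`Sub(y)` is the whole symmetric group. -/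
theorem subnormalizer_of_cycle_product (ℓ m : ℕ) (hℓ : 1 ≤ ℓ) (hm : 1 ≤ m)
    (y : Equiv.Perm (Fin (ℓ * 2 ^ m)))
    (hy : y.cycleType = Multiset.replicate ℓ (2 ^ m)) :
    (ℓ = 1 → ∀ P : Sylow 2 (Equiv.Perm (Fin (ℓ * 2 ^ m))),
      y ∈ (P : Subgroup (Equiv.Perm (Fin (ℓ * 2 ^ m)))) →
        subnormalizer y = (P : Subgroup (Equiv.Perm (Fin (ℓ * 2 ^ m))))) ∧
    (1 < ℓ → subnormalizer y = ⊤) := by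
  have hm1 := Equiv.Perm.pow_eq_one_of_cycleType_eq_replicate hy
  have hne := Equiv.Perm.apply_ne_self_of_cycleType_eq_replicate hy (Fintype.card_fin _)
  refine ⟨fun h1 P hP => ?_, fun h1 => ?_⟩
  · have hc : y.IsCycle := Equiv.Perm.card_cycleType_eq_one.1 (by simp [hy, h1])
    exact Equiv.Perm.subnormalizer_eq_sylow (fun u v => hc.sameCycle (hne u) (hne v)) hm1 P hP
  · exact Equiv.Perm.subnormalizer_eq_top hm1
      (fun _ x => Equiv.Perm.zpow_eq_one_of_cycleType_eq_replicate hy (hne x))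
      fun a => Equiv.Perm.exists_not_sameCycle_of_cycleType_eq_replicate hy h1.ne' (hne a)

end
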